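/- For all κ, κ' > 0 there exists a constant C(κ,κ') > 0 such that for all smooth compactly supported maps θ, θ₁ : ℝ² → ℝ² and u : ℝ² → ℝ², |m(θ,θ₁,u)| ≤ κ ‖∇u‖₂² + κ' ‖Δθ‖₂² + C(κ,κ') ‖∇θ₁‖₂² ‖Δθ₁‖₂² ‖∇θ‖₂². -/

import Mathlib

open MeasureTheory

noncomputable section

/-- Partial derivative of a real-valued function on `ℝ²` in the `i`-th coordinate direction. -/
def pderivE (g : (Fin 2 → ℝ) → ℝ) (i : Fin 2) (x : Fin 2 → ℝ) : ℝ :=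
  fderiv ℝ g x (Pi.single i 1)

/-- The Navier–Stokes trilinear form
`b(u,v,w) = ∑ i j, ∫ u_i ∂_i v_j w_j`. -/
def formB (u v w : (Fin 2 → ℝ) → (Fin 2 → ℝ)) : ℝ :=
  ∑ i : Fin 2, ∑ j : Fin 2, ∫ x : Fin 2 → ℝ, u x i * pderivE (fun y => v y j) i x * w x j

/-- The Ericksen stress trilinear form
`m(θ₁,θ₂,u) = −∑ i j k, ∫ ∂_i θ₁^k ∂_j θ₂^k ∂_j u^i`. -/
def formM (t1 t2 u : (Fin 2 → ℝ) → (Fin 2 → ℝ)) : ℝ :=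
  -∑ i : Fin 2, ∑ j : Fin 2, ∑ k : Fin 2, ∫ x : Fin 2 → ℝ,
    pderivE (fun y => t1 y k) i x * pderivE (fun y => t2 y k) j x *
      pderivE (fun y => u y i) j x

/-- `u` is divergence-free: `∂₁u₁ + ∂₂u₂ = 0` everywhere. -/
def DivergenceFree (u : (Fin 2 → ℝ) → (Fin 2 → ℝ)) : Prop :=
  ∀ x, (∑ i : Fin 2, pderivE (fun y => u y i) i x) = 0

/-- The `L²` norm of an `ℝ²`-valued map. -/
def l2norm (g : (Fin 2 → ℝ) → (Fin 2 → ℝ)) : ℝ :=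
  (∫ x : Fin 2 → ℝ, ∑ k : Fin 2, (g x k) ^ 2) ^ (1/2 : ℝ)

/-- The `L²` norm of the gradient of an `ℝ²`-valued map. -/
def gradNorm (g : (Fin 2 → ℝ) → (Fin 2 → ℝ)) : ℝ :=
  (∫ x : Fin 2 → ℝ, ∑ i : Fin 2, ∑ k : Fin 2, (pderivE (fun y => g y k) i x) ^ 2) ^ (1/2 : ℝ)

/-- The `L²` norm of a real-valued function. -/
def l2normR (g : (Fin 2 → ℝ) → ℝ) : ℝ :=
  (∫ x : Fin 2 → ℝ, (g x) ^ 2) ^ (1/2 : ℝ)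

/-- The `L²` norm of the gradient of a real-valued function. -/
def gradNormR (g : (Fin 2 → ℝ) → ℝ) : ℝ :=
  (∫ x : Fin 2 → ℝ, ∑ i : Fin 2, (pderivE g i x) ^ 2) ^ (1/2 : ℝ)

/-- The `k`-th component of the (componentwise) Laplacian `Δg_k = ∂₁₁ g_k + ∂₂₂ g_k`. -/
def lapComp (g : (Fin 2 → ℝ) → (Fin 2 → ℝ)) (k : Fin 2) (x : Fin 2 → ℝ) : ℝ :=
  ∑ i : Fin 2, pderivE (pderivE (fun y => g y k) i) i x

/-- The `L²` norm of the componentwise Laplacian. -/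
def lapNorm (g : (Fin 2 → ℝ) → (Fin 2 → ℝ)) : ℝ :=
  (∫ x : Fin 2 → ℝ, ∑ k : Fin 2, (lapComp g k x) ^ 2) ^ (1/2 : ℝ)

/-- The `L^{4N+2}` norm of an `ℝ²`-valued map (written using `|v|^{4N+2} = (|v|²)^{2N+1}`). -/
def lqNorm (N : ℕ) (g : (Fin 2 → ℝ) → (Fin 2 → ℝ)) : ℝ :=
  (∫ x : Fin 2 → ℝ, (∑ k : Fin 2, (g x k) ^ 2) ^ (2 * N + 1)) ^ (1 / (4 * (N:ℝ) + 2))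

/-- The polynomial nonlinearity `f(θ) = (∑_{j=0}^{N} b_j |θ|^{2j}) θ`. -/
def polyF (N : ℕ) (b : Fin (N + 1) → ℝ) (v : Fin 2 → ℝ) : Fin 2 → ℝ :=
  fun k => (∑ j : Fin (N + 1), b j * (∑ l : Fin 2, (v l) ^ 2) ^ (j : ℕ)) * v k

section CauchySchwarz

variable {α : Type*} [MeasurableSpace α] {μ : Measure α}

/-- Cauchy–Schwarz inequality for real-valued functions. -/
theorem sq_integral_mul_le {f g : α → ℝ} (hf : Integrable (fun x => f x ^ 2) μ)
    (hg : Integrable (fun x => g x ^ 2) μ) (hfg : Integrable (fun x => f x * g x) μ) :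
    (∫ x, f x * g x ∂μ) ^ 2 ≤ (∫ x, f x ^ 2 ∂μ) * ∫ x, g x ^ 2 ∂μ := by
  have h := discrim_le_zero (a := ∫ x, f x ^ 2 ∂μ) (b := 2 * ∫ x, f x * g x ∂μ)
    (c := ∫ x, g x ^ 2 ∂μ) fun t => by
      have h0 : 0 ≤ ∫ x, (t * f x + g x) ^ 2 ∂μ := integral_nonneg fun x => sq_nonneg _
      have h1 : ∫ x, (t * f x + g x) ^ 2 ∂μ =
          ∫ x, (t * t * f x ^ 2 + 2 * t * (f x * g x) + g x ^ 2) ∂μ := by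
        congr 1 with x
        ring
      have hF : Integrable (fun x => t * t * f x ^ 2) μ := hf.const_mul _
      have hH : Integrable (fun x => 2 * t * (f x * g x)) μ := hfg.const_mul _
      rw [h1, integral_add (by exact hF.add hH) hg, integral_add hF hH, integral_const_mul,
        integral_const_mul] at h0
      linarith
  rw [discrim] at h
  linarith

/-- Young's inequality for an integral of a product. -/
theorem abs_integral_mul_le_young {f g : α → ℝ} (hf : Integrable (fun x => f x ^ 2) μ)
    (hg : Integrable (fun x => g x ^ 2) μ) (hfg : Integrable (fun x => f x * g x) μ)
    {δ : ℝ} (hδ : 0 < δ) :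
    |∫ x, f x * g x ∂μ| ≤ δ * (∫ x, g x ^ 2 ∂μ) + (∫ x, f x ^ 2 ∂μ) / (4 * δ) := by
  have h := sq_integral_mul_le hf hg hfg
  have hF : 0 ≤ ∫ x, f x ^ 2 ∂μ := integral_nonneg fun x => sq_nonneg _
  have hG : 0 ≤ ∫ x, g x ^ 2 ∂μ := integral_nonneg fun x => sq_nonneg _
  refine abs_le_of_sq_le_sq (h.trans ?_) (by positivity)
  have h4 : (∫ x, f x ^ 2 ∂μ) * (∫ x, g x ^ 2 ∂μ) =
      δ * (∫ x, g x ^ 2 ∂μ) * ((∫ x, f x ^ 2 ∂μ) / (4 * δ)) * 4 := by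
    field_simp
  nlinarith [sq_nonneg (δ * (∫ x, g x ^ 2 ∂μ) - (∫ x, f x ^ 2 ∂μ) / (4 * δ))]

end CauchySchwarz

section PartialDerivatives

variable {f g : (Fin 2 → ℝ) → ℝ}

theorem ContDiff.pderivE (hf : ContDiff ℝ (⊤ : ℕ∞) f) (i : Fin 2) :
    ContDiff ℝ (⊤ : ℕ∞) (pderivE f i) :=
  (hf.fderiv_right (by simp)).clm_apply contDiff_const

theorem HasCompactSupport.pderivE (hf : HasCompactSupport f) (i : Fin 2) :
    HasCompactSupport (pderivE f i) :=
  hf.fderiv_apply (𝕜 := ℝ) _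

theorem pderivE_comm (hf : ContDiff ℝ (⊤ : ℕ∞) f) (i j : Fin 2) :
    pderivE (pderivE f i) j = pderivE (pderivE f j) i := by
  have hd : Differentiable ℝ (fderiv ℝ f) :=
    (hf.fderiv_right (m := (⊤ : ℕ∞)) (by simp)).differentiable (by simp)
  have key : ∀ (i j : Fin 2) (x : Fin 2 → ℝ), pderivE (pderivE f i) j x =
      fderiv ℝ (fderiv ℝ f) x (Pi.single j 1) (Pi.single i 1) := fun i j x => by
    change fderiv ℝ (fun y => fderiv ℝ f y (Pi.single i 1)) x (Pi.single j 1) = _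
    rw [fderiv_clm_apply (hd x) (differentiableAt_const _)]
    simp
  ext x
  rw [key, key]
  exact ((contDiff_infty.1 hf 2).contDiffAt.isSymmSndFDerivAt (by simp)).eq _ _

theorem integral_mul_pderivE (hf : ContDiff ℝ (⊤ : ℕ∞) f) (hfc : HasCompactSupport f)
    (hg : ContDiff ℝ (⊤ : ℕ∞) g) (i : Fin 2) :
    ∫ x, f x * pderivE g i x = -∫ x, pderivE f i x * g x :=
  integral_mul_fderiv_eq_neg_fderiv_mul_of_integrable
    (((hf.pderivE i).continuous.mul hg.continuous).integrable_of_hasCompactSupport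
      (hfc.pderivE i).mul_right)
    ((hf.continuous.mul (hg.pderivE i).continuous).integrable_of_hasCompactSupport hfc.mul_right)
    ((hf.continuous.mul hg.continuous).integrable_of_hasCompactSupport hfc.mul_right)
    (fun x _ => hf.differentiable (by simp) x) (fun x _ => hg.differentiable (by simp) x)

theorem integral_sq_pderivE_pderivE (hf : ContDiff ℝ (⊤ : ℕ∞) f) (hfc : HasCompactSupport f)
    (i j : Fin 2) :
    ∫ x, pderivE (pderivE f i) j x ^ 2 =
      ∫ x, pderivE (pderivE f i) i x * pderivE (pderivE f j) j x := by
  have h1 := integral_mul_pderivE ((hf.pderivE i).pderivE j) ((hfc.pderivE i).pderivE j)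
    (hf.pderivE i) j
  have h2 := integral_mul_pderivE ((hf.pderivE j).pderivE j) ((hfc.pderivE j).pderivE j)
    (hf.pderivE i) i
  have h3 : pderivE (pderivE (pderivE f i) j) j = pderivE (pderivE (pderivE f j) j) i := by
    rw [pderivE_comm hf i j, pderivE_comm (hf.pderivE j) i j]
  rw [h3, ← h2] at h1
  simp only [sq]
  rw [h1]
  simp only [mul_comm]

theorem HasCompactSupport.sq (hf : HasCompactSupport f) : HasCompactSupport fun x => f x ^ 2 := by
  simp only [pow_two]
  exact hf.mul_right

theorem Continuous.integrable_sq_of_hasCompactSupport (hf : Continuous f)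
    (hfc : HasCompactSupport f) : Integrable fun x => f x ^ 2 :=
  (hf.pow 2).integrable_of_hasCompactSupport hfc.sq

/-- The second derivatives are controlled by the Laplacian in `L²`. -/
theorem sum_integral_sq_pderivE_pderivE_le (hf : ContDiff ℝ (⊤ : ℕ∞) f)
    (hfc : HasCompactSupport f) (i : Fin 2) :
    ∑ j, ∫ x, pderivE (pderivE f i) j x ^ 2 ≤ ∫ x, (∑ j, pderivE (pderivE f j) j x) ^ 2 := by
  have hsq : ∀ j, Integrable fun x => pderivE (pderivE f j) j x ^ 2 := fun j =>
    ((hf.pderivE j).pderivE j).continuous.integrable_sq_of_hasCompactSupport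
      ((hfc.pderivE j).pderivE j)
  have hmul : Integrable fun x => pderivE (pderivE f 0) 0 x * pderivE (pderivE f 1) 1 x :=
    (((hf.pderivE 0).pderivE 0).continuous.mul
      ((hf.pderivE 1).pderivE 1).continuous).integrable_of_hasCompactSupport
      ((hfc.pderivE 0).pderivE 0).mul_right
  have hlap : ∫ x, (∑ j, pderivE (pderivE f j) j x) ^ 2 =
      (∫ x, pderivE (pderivE f 0) 0 x ^ 2) + (∫ x, pderivE (pderivE f 1) 1 x ^ 2) +
        2 * ∫ x, pderivE (pderivE f 0) 1 x ^ 2 := by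
    rw [integral_sq_pderivE_pderivE hf hfc 0 1, ← integral_add (hsq 0) (hsq 1),
      ← integral_const_mul, ← integral_add (by exact (hsq 0).add (hsq 1)) (hmul.const_mul 2)]
    congr 1 with x
    rw [Fin.sum_univ_two]
    ring
  have hnonneg : ∀ j k, 0 ≤ ∫ x, pderivE (pderivE f j) k x ^ 2 := fun j k =>
    integral_nonneg fun x => sq_nonneg _
  rw [hlap, Fin.sum_univ_two]
  fin_cases i
  · simp only [Fin.zero_eta]
    linarith [hnonneg 1 1, hnonneg 0 1]
  · simp only [Fin.mk_one]
    rw [pderivE_comm hf 1 0]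
    linarith [hnonneg 0 0, hnonneg 0 1]

theorem norm_fderiv_le_sum_abs_pderivE (f : (Fin 2 → ℝ) → ℝ) (x : Fin 2 → ℝ) :
    ‖fderiv ℝ f x‖ ≤ ∑ i, |pderivE f i x| := by
  refine ContinuousLinearMap.opNorm_le_bound _ (by positivity) fun v => ?_
  have hv : v = ∑ i, v i • (Pi.single i 1 : Fin 2 → ℝ) := by
    ext j
    simp [Finset.sum_apply, Pi.single_apply]
  conv_lhs => rw [hv]
  rw [map_sum, Finset.sum_mul]
  refine (norm_sum_le _ _).trans (Finset.sum_le_sum fun i _ => ?_)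
  rw [map_smul, norm_smul, mul_comm]
  exact mul_le_mul_of_nonneg_left (norm_le_pi_norm v i) (abs_nonneg _)

/-- The Gagliardo–Nirenberg–Sobolev inequality `‖f‖₂ ≤ C‖∇f‖₁` in the plane. -/
theorem exists_integral_sq_le_sq_integral_pderivE :
    ∃ C > (0 : ℝ), ∀ f : (Fin 2 → ℝ) → ℝ, ContDiff ℝ (⊤ : ℕ∞) f → HasCompactSupport f →
      ∫ x, f x ^ 2 ≤ C * (∫ x, ∑ i, |pderivE f i x|) ^ 2 := by
  set K := lintegralPowLePowLIntegralFDerivConst (volume : Measure (Fin 2 → ℝ)) 2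
  refine ⟨K + 1, by positivity, fun f hf hfc => ?_⟩
  have hp : Real.HolderConjugate (Module.finrank ℝ (Fin 2 → ℝ)) 2 := by
    rw [Module.finrank_fin_fun]
    exact_mod_cast Real.HolderConjugate.two_two
  have h := lintegral_pow_le_pow_lintegral_fderiv (volume : Measure (Fin 2 → ℝ))
    (hf.of_le (by simp)) hfc hp
  have hDf : Continuous (fderiv ℝ f) := hf.continuous_fderiv (by simp)
  have hDint : Integrable (fderiv ℝ f) := hDf.integrable_of_hasCompactSupport (hfc.fderiv ℝ)
  have hfint := hf.continuous.integrable_sq_of_hasCompactSupport hfc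
  have hl : ∫⁻ x, ‖f x‖ₑ ^ (2 : ℝ) = ENNReal.ofReal (∫ x, f x ^ 2) := by
    rw [ofReal_integral_eq_lintegral_ofReal hfint (.of_forall fun x => sq_nonneg _)]
    congr 1 with x
    rw [Real.enorm_eq_ofReal_abs, ENNReal.ofReal_rpow_of_nonneg (abs_nonneg _) (by norm_num)]
    simp
  rw [hl, ← ofReal_integral_norm_eq_lintegral_enorm hDint,
    ENNReal.ofReal_rpow_of_nonneg (integral_nonneg fun x => norm_nonneg _) (by norm_num),
    ← ENNReal.ofReal_coe_nnreal, ← ENNReal.ofReal_mul (by positivity),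
    ENNReal.ofReal_le_ofReal_iff (by positivity)] at h
  rw [Real.rpow_two] at h
  have hsum : Integrable fun x => ∑ i, |pderivE f i x| :=
    integrable_finsetSum _ fun i _ =>
      ((hf.pderivE i).continuous.integrable_of_hasCompactSupport (hfc.pderivE i)).abs
  have hle : ∫ x, ‖fderiv ℝ f x‖ ≤ ∫ x, ∑ i, |pderivE f i x| :=
    integral_mono hDint.norm hsum fun x => norm_fderiv_le_sum_abs_pderivE f x
  have h0 : 0 ≤ ∫ x, ‖fderiv ℝ f x‖ := integral_nonneg fun x => norm_nonneg _
  calc _ ≤ _ := h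
    _ ≤ (K + 1 : ℝ) * _ := by gcongr; linarith

theorem pderivE_sq (hf : ContDiff ℝ (⊤ : ℕ∞) f) (i : Fin 2) (x : Fin 2 → ℝ) :
    pderivE (fun y => f y ^ 2) i x = 2 * (f x * pderivE f i x) := by
  have hd : DifferentiableAt ℝ f x := hf.differentiable (by simp) x
  simp only [pderivE]
  rw [fderiv_fun_pow 2 hd]
  simp
  ring

/-- Ladyzhenskaya's inequality in the plane. -/
theorem exists_ladyzhenskaya :
    ∃ C > (0 : ℝ), ∀ f : (Fin 2 → ℝ) → ℝ, ContDiff ℝ (⊤ : ℕ∞) f → HasCompactSupport f →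
      ∫ x, f x ^ 4 ≤ C * (∫ x, f x ^ 2) * ∑ i, ∫ x, pderivE f i x ^ 2 := by
  obtain ⟨C, hC, H⟩ := exists_integral_sq_le_sq_integral_pderivE
  refine ⟨8 * C, by positivity, fun f hf hfc => ?_⟩
  have h := H (fun y => f y ^ 2) (hf.pow 2)
    hfc.sq
  have hD : Continuous fun x => ∑ i, |pderivE f i x| :=
    continuous_finsetSum _ fun i _ => (hf.pderivE i).continuous.abs
  have hDc : HasCompactSupport fun x => ∑ i, |pderivE f i x| := by
    simp only [Fin.sum_univ_two]
    exact (hfc.pderivE 0).abs.add (hfc.pderivE 1).abs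
  have hcs := sq_integral_mul_le (μ := volume) (f := fun x => |f x|)
    (g := fun x => ∑ i, |pderivE f i x|)
    (hf.continuous.abs.integrable_sq_of_hasCompactSupport hfc.abs)
    (hD.integrable_sq_of_hasCompactSupport hDc)
    ((hf.continuous.abs.mul hD).integrable_of_hasCompactSupport hDc.mul_left)
  have hi : ∀ i, Integrable fun x => pderivE f i x ^ 2 := fun i =>
    (hf.pderivE i).continuous.integrable_sq_of_hasCompactSupport (hfc.pderivE i)
  have hgrad : ∫ x, (∑ i, |pderivE f i x|) ^ 2 ≤ 2 * ∑ i, ∫ x, pderivE f i x ^ 2 := by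
    rw [← integral_finsetSum _ fun i _ => hi i, ← integral_const_mul]
    refine integral_mono (hD.integrable_sq_of_hasCompactSupport hDc)
      ((integrable_finsetSum _ fun i _ => hi i).const_mul 2) fun x => ?_
    simp only [Fin.sum_univ_two]
    nlinarith [sq_nonneg (|pderivE f 0 x| - |pderivE f 1 x|), sq_abs (pderivE f 0 x),
      sq_abs (pderivE f 1 x)]
  have hprod : ∫ x, ∑ i, |pderivE (fun y => f y ^ 2) i x| =
      2 * ∫ x, |f x| * ∑ i, |pderivE f i x| := by
    rw [← integral_const_mul]
    congr 1 with x
    simp only [pderivE_sq hf, abs_mul, Finset.mul_sum, abs_two]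
  simp only [sq_abs] at hcs
  rw [hprod] at h
  have hf2 : 0 ≤ ∫ x, f x ^ 2 := integral_nonneg fun x => sq_nonneg _
  calc ∫ x, f x ^ 4 = ∫ x, (f x ^ 2) ^ 2 := by simp only [← pow_mul]
    _ ≤ C * (2 * ∫ x, |f x| * ∑ i, |pderivE f i x|) ^ 2 := h
    _ = 4 * C * (∫ x, |f x| * ∑ i, |pderivE f i x|) ^ 2 := by ring
    _ ≤ 4 * C * ((∫ x, f x ^ 2) * (2 * ∑ i, ∫ x, pderivE f i x ^ 2)) := by
      gcongr
      exact hcs.trans (by gcongr)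
    _ = _ := by ring

/-- Weighted Hölder inequality with exponents `4, 4, 2`. -/
theorem abs_integral_mul_mul_le {a b c : (Fin 2 → ℝ) → ℝ} (ha : Continuous a)
    (hac : HasCompactSupport a) (hb : Continuous b) (hbc : HasCompactSupport b)
    (hc : Continuous c) (hcc : HasCompactSupport c) {δ M : ℝ} (hδ : 0 < δ) (hM : 0 ≤ M)
    (h : (∫ x, a x ^ 4) * ∫ x, b x ^ 4 ≤ (4 * δ * M) ^ 2) :
    |∫ x, a x * b x * c x| ≤ δ * (∫ x, c x ^ 2) + M := by
  have hab : Integrable fun x => (a x * b x) ^ 2 :=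
    (ha.mul hb).integrable_sq_of_hasCompactSupport hac.mul_right
  have habc : Integrable fun x => a x * b x * c x :=
    ((ha.mul hb).mul hc).integrable_of_hasCompactSupport hcc.mul_left
  have hY := abs_integral_mul_le_young hab (hc.integrable_sq_of_hasCompactSupport hcc) habc hδ
  have ha4 : Integrable fun x => (a x ^ 2) ^ 2 :=
    (ha.pow 2).integrable_sq_of_hasCompactSupport hac.sq
  have hb4 : Integrable fun x => (b x ^ 2) ^ 2 :=
    (hb.pow 2).integrable_sq_of_hasCompactSupport hbc.sq
  have hCS : (∫ x, (a x * b x) ^ 2) ^ 2 ≤ (∫ x, a x ^ 4) * ∫ x, b x ^ 4 := by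
    have := sq_integral_mul_le ha4 hb4 (by simpa only [mul_pow] using hab)
    simpa only [← mul_pow, ← pow_mul, Nat.reduceMul] using this
  have hX := le_of_abs_le (abs_le_of_sq_le_sq (hCS.trans h) (by positivity))
  have hX' := (div_le_iff₀' (by positivity : 0 < 4 * δ)).2 hX
  linarith

end PartialDerivatives

section Norms

variable {g : (Fin 2 → ℝ) → (Fin 2 → ℝ)}

theorem ContDiff.component (hg : ContDiff ℝ (⊤ : ℕ∞) g) (k : Fin 2) :
    ContDiff ℝ (⊤ : ℕ∞) fun y => g y k :=
  contDiff_pi.1 hg k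

theorem HasCompactSupport.component (hg : HasCompactSupport g) (k : Fin 2) :
    HasCompactSupport fun y => g y k :=
  hg.comp_left (g := fun v : Fin 2 → ℝ => v k) rfl

theorem gradNorm_sq (g : (Fin 2 → ℝ) → (Fin 2 → ℝ)) :
    gradNorm g ^ 2 = ∫ x, ∑ i, ∑ k, pderivE (fun y => g y k) i x ^ 2 := by
  rw [gradNorm, ← Real.sqrt_eq_rpow, Real.sq_sqrt (integral_nonneg fun x => by positivity)]

theorem lapNorm_sq (g : (Fin 2 → ℝ) → (Fin 2 → ℝ)) :
    lapNorm g ^ 2 = ∫ x, ∑ k, lapComp g k x ^ 2 := by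
  rw [lapNorm, ← Real.sqrt_eq_rpow, Real.sq_sqrt (integral_nonneg fun x => by positivity)]

theorem integral_sq_pderivE_le_gradNorm_sq (hg : ContDiff ℝ (⊤ : ℕ∞) g)
    (hgc : HasCompactSupport g) (i k : Fin 2) :
    ∫ x, pderivE (fun y => g y k) i x ^ 2 ≤ gradNorm g ^ 2 := by
  have hint : ∀ i k, Integrable fun x => pderivE (fun y => g y k) i x ^ 2 := fun i k =>
    ((hg.component k).pderivE i).continuous.integrable_sq_of_hasCompactSupport
      ((hgc.component k).pderivE i)
  rw [gradNorm_sq]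
  refine integral_mono (hint i k)
    (integrable_finsetSum _ fun i _ => integrable_finsetSum _ fun k _ => hint i k) fun x => ?_
  calc pderivE (fun y => g y k) i x ^ 2 ≤ ∑ k, pderivE (fun y => g y k) i x ^ 2 :=
        Finset.single_le_sum (f := fun k => pderivE (fun y => g y k) i x ^ 2)
          (fun _ _ => sq_nonneg _) (Finset.mem_univ k)
    _ ≤ _ := Finset.single_le_sum (f := fun i => ∑ k, pderivE (fun y => g y k) i x ^ 2)
          (fun _ _ => Finset.sum_nonneg fun _ _ => sq_nonneg _) (Finset.mem_univ i)

theorem sum_integral_sq_pderivE_pderivE_le_lapNorm_sq (hg : ContDiff ℝ (⊤ : ℕ∞) g)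
    (hgc : HasCompactSupport g) (i k : Fin 2) :
    ∑ j, ∫ x, pderivE (pderivE (fun y => g y k) i) j x ^ 2 ≤ lapNorm g ^ 2 := by
  have hint : ∀ k, Integrable fun x => lapComp g k x ^ 2 := fun k => by
    refine Continuous.integrable_sq_of_hasCompactSupport (continuous_finsetSum _ fun i _ =>
      (((hg.component k).pderivE i).pderivE i).continuous) ?_
    unfold lapComp
    simp only [Fin.sum_univ_two]
    exact (((hgc.component k).pderivE 0).pderivE 0).add (((hgc.component k).pderivE 1).pderivE 1)
  refine (sum_integral_sq_pderivE_pderivE_le (hg.component k) (hgc.component k) i).trans ?_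
  rw [lapNorm_sq]
  exact integral_mono (hint k) (integrable_finsetSum _ fun k _ => hint k) fun x =>
    Finset.single_le_sum (f := fun k => lapComp g k x ^ 2)
      (fun _ _ => sq_nonneg _) (Finset.mem_univ k)

theorem exists_integral_pow_four_pderivE_le :
    ∃ C > (0 : ℝ), ∀ g : (Fin 2 → ℝ) → (Fin 2 → ℝ), ContDiff ℝ (⊤ : ℕ∞) g →
      HasCompactSupport g → ∀ i k,
      ∫ x, pderivE (fun y => g y k) i x ^ 4 ≤ C * gradNorm g ^ 2 * lapNorm g ^ 2 := by
  obtain ⟨C, hC, H⟩ := exists_ladyzhenskaya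
  refine ⟨C, hC, fun g hg hgc i k =>
    (H _ ((hg.component k).pderivE i) ((hgc.component k).pderivE i)).trans ?_⟩
  gcongr
  · exact integral_sq_pderivE_le_gradNorm_sq hg hgc i k
  · exact sum_integral_sq_pderivE_pderivE_le_lapNorm_sq hg hgc i k

end Norms

/-- Bound for a single summand of the trilinear form `formM`. -/
theorem exists_abs_integral_pderivE_mul_mul_le {δ ε : ℝ} (hδ : 0 < δ) (hε : 0 < ε) :
    ∃ C > (0 : ℝ), ∀ θ θ₁ u : (Fin 2 → ℝ) → (Fin 2 → ℝ),
      ContDiff ℝ (⊤ : ℕ∞) θ → HasCompactSupport θ →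
      ContDiff ℝ (⊤ : ℕ∞) θ₁ → HasCompactSupport θ₁ →
      ContDiff ℝ (⊤ : ℕ∞) u → HasCompactSupport u → ∀ i j k,
      |∫ x, pderivE (fun y => θ y k) i x * pderivE (fun y => θ₁ y k) j x *
          pderivE (fun y => u y i) j x| ≤
        δ * gradNorm u ^ 2 + ε * lapNorm θ ^ 2 +
          C * gradNorm θ₁ ^ 2 * lapNorm θ₁ ^ 2 * gradNorm θ ^ 2 := by
  obtain ⟨K, hK, H⟩ := exists_integral_pow_four_pderivE_le
  refine ⟨K ^ 2 / (64 * δ ^ 2 * ε), by positivity,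
    fun θ θ₁ u hθ hθc hθ₁ hθ₁c hu huc i j k => ?_⟩
  have hK4 : K * gradNorm θ ^ 2 * lapNorm θ ^ 2 * (K * gradNorm θ₁ ^ 2 * lapNorm θ₁ ^ 2) ≤
      (4 * δ * (ε * lapNorm θ ^ 2 +
        K ^ 2 / (64 * δ ^ 2 * ε) * gradNorm θ₁ ^ 2 * lapNorm θ₁ ^ 2 * gradNorm θ ^ 2)) ^ 2 := by
    refine le_of_eq_of_le ?_ (mul_le_mul_of_nonneg_left (four_mul_le_sq_add (ε * lapNorm θ ^ 2)
      (K ^ 2 / (64 * δ ^ 2 * ε) * gradNorm θ₁ ^ 2 * lapNorm θ₁ ^ 2 * gradNorm θ ^ 2))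
      (sq_nonneg (4 * δ)) |>.trans_eq (mul_pow _ _ _).symm)
    field_simp
    ring
  refine (abs_integral_mul_mul_le ((hθ.component k).pderivE i).continuous
    ((hθc.component k).pderivE i) ((hθ₁.component k).pderivE j).continuous
    ((hθ₁c.component k).pderivE j) ((hu.component i).pderivE j).continuous
    ((huc.component i).pderivE j) hδ (by positivity) ((mul_le_mul (H θ hθ hθc i k)
      (H θ₁ hθ₁ hθ₁c j k) (integral_nonneg fun x => by positivity) (by positivity)).trans
        hK4)).trans ?_
  have := mul_le_mul_of_nonneg_left (integral_sq_pderivE_le_gradNorm_sq hu huc j i) hδ.le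
  linarith

/-- the uniqueness-proof estimate
`|m(θ,θ₁,u)| ≤ κ‖∇u‖₂² + κ'‖Δθ‖₂² + C(κ,κ')‖∇θ₁‖₂²‖Δθ₁‖₂²‖∇θ‖₂²`. -/
theorem formM_uniqueness_estimate :
    ∀ κ > (0:ℝ), ∀ κ' > (0:ℝ), ∃ C > (0:ℝ), ∀ θ θ₁ u : (Fin 2 → ℝ) → (Fin 2 → ℝ),
      ContDiff ℝ (⊤ : ℕ∞) θ → HasCompactSupport θ →
      ContDiff ℝ (⊤ : ℕ∞) θ₁ → HasCompactSupport θ₁ →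
      ContDiff ℝ (⊤ : ℕ∞) u → HasCompactSupport u →
      |formM θ θ₁ u| ≤
        κ * (gradNorm u) ^ 2 + κ' * (lapNorm θ) ^ 2 +
          C * (gradNorm θ₁) ^ 2 * (lapNorm θ₁) ^ 2 * (gradNorm θ) ^ 2 := by
  intro κ hκ κ' hκ'
  obtain ⟨C, hC, H⟩ := exists_abs_integral_pderivE_mul_mul_le (δ := κ / 8) (ε := κ' / 8)
    (by positivity) (by positivity)
  refine ⟨8 * C, by positivity, fun θ θ₁ u hθ hθc hθ₁ hθ₁c hu huc => ?_⟩
  rw [formM, abs_neg]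
  calc _ ≤ ∑ i : Fin 2, ∑ j : Fin 2, ∑ k : Fin 2, |∫ x : Fin 2 → ℝ,
        pderivE (fun y => θ y k) i x * pderivE (fun y => θ₁ y k) j x *
          pderivE (fun y => u y i) j x| :=
        (Finset.abs_sum_le_sum_abs _ _).trans <| Finset.sum_le_sum fun i _ =>
          (Finset.abs_sum_le_sum_abs _ _).trans <| Finset.sum_le_sum fun j _ =>
            Finset.abs_sum_le_sum_abs _ _
    _ ≤ ∑ i : Fin 2, ∑ j : Fin 2, ∑ k : Fin 2, _ :=
        Finset.sum_le_sum fun i _ => Finset.sum_le_sum fun j _ => Finset.sum_le_sum fun k _ =>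
          H θ θ₁ u hθ hθc hθ₁ hθ₁c hu huc i j k
    _ = _ := by
        simp only [Finset.sum_const, Finset.card_univ, Fintype.card_fin, nsmul_eq_mul]
        push_cast
        ring

end
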